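/- arXiv:2004.03058 — 4 statements merged into one kernel-verified Lean document; each statement's English description precedes it below -/
import Mathlib

section
/- For a positive integer m, let S_m = {(a, b, c, d) ∈ P_m⁴ : gcd(b, c) = 1 and deg(a·b·c·d) = m}. Then |S_m| = q^m · ( ((q − 1)/q)·C(m+1, 3) + (m + 1)² ), where C(m+1,3) is the binomial coefficient. -/
open Polynomial

section FiberCount

variable {α β : Type*}

/-- A fiber of the sum of two gradings splits along the antidiagonal. -/
def fiberAddEquiv (f : α → ℕ) (g : β → ℕ) (n : ℕ) :
    {x : α × β // f x.1 + g x.2 = n} ≃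
      Σ p : Finset.HasAntidiagonal.antidiagonal n, {a // f a = p.1.1} × {b // g b = p.1.2} where
  toFun x := ⟨⟨(f x.1.1, g x.1.2), Finset.HasAntidiagonal.mem_antidiagonal.2 x.2⟩,
    ⟨x.1.1, rfl⟩, ⟨x.1.2, rfl⟩⟩
  invFun y := ⟨(y.2.1.1, y.2.2.1), by
    rw [y.2.1.2, y.2.2.2]; exact Finset.HasAntidiagonal.mem_antidiagonal.1 y.1.2⟩
  left_inv _ := rfl
  right_inv := by
    rintro ⟨⟨⟨i, j⟩, h⟩, ⟨a, ha⟩, ⟨b, hb⟩⟩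
    dsimp only at ha hb
    subst ha hb
    rfl

theorem finite_fiber_add {f : α → ℕ} {g : β → ℕ} (hf : ∀ n, Finite {a // f a = n})
    (hg : ∀ n, Finite {b // g b = n}) (n : ℕ) : Finite {x : α × β // f x.1 + g x.2 = n} :=
  Finite.of_equiv _ (fiberAddEquiv f g n).symm

theorem card_fiber_add {f : α → ℕ} {g : β → ℕ} (hf : ∀ n, Finite {a // f a = n})
    (hg : ∀ n, Finite {b // g b = n}) (n : ℕ) :
    Nat.card {x : α × β // f x.1 + g x.2 = n} =
      ∑ p ∈ Finset.HasAntidiagonal.antidiagonal n,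
        Nat.card {a // f a = p.1} * Nat.card {b // g b = p.2} := by
  rw [Nat.card_congr (fiberAddEquiv f g n), Nat.card_sigma]
  simp only [Nat.card_prod]
  exact Finset.sum_coe_sort (Finset.HasAntidiagonal.antidiagonal n)
    fun p => Nat.card {a // f a = p.1} * Nat.card {b // g b = p.2}

theorem card_fiber_add_eq_choose {f : α → ℕ} {g : β → ℕ} {q r : ℕ}
    (hf : ∀ n, Finite {a // f a = n}) (hg : ∀ n, Finite {b // g b = n})
    (hfq : ∀ n, Nat.card {a // f a = n} = q ^ n)
    (hgq : ∀ n, Nat.card {b // g b = n} = q ^ n * (n + r).choose r) (n : ℕ) :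
    Nat.card {x : α × β // f x.1 + g x.2 = n} = q ^ n * (n + (r + 1)).choose (r + 1) := by
  rw [card_fiber_add hf hg, Finset.Nat.antidiagonal_eq_map', Finset.sum_map]
  simp only [hfq, hgq]
  rw [← add_assoc, ← Nat.sum_range_add_choose, Finset.mul_sum]
  refine Finset.sum_congr rfl fun i hi => ?_
  change q ^ (n - i) * (q ^ i * (i + r).choose r) = _
  rw [← mul_assoc, ← pow_add, Nat.sub_add_cancel (Finset.mem_range_succ_iff.1 hi)]

end FiberCount

section MonicPolynomial

variable (F : Type*) [Field F]

/-- The monic polynomials over a field. -/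
abbrev MonicPoly := {p : F[X] // p.Monic}

/-- Quadruples of monic polynomials. -/
abbrev MonicQuad := MonicPoly F × MonicPoly F × MonicPoly F × MonicPoly F

/-- Quadruples of monic polynomials whose two middle entries are coprime. -/
abbrev CoprimeQuad := {t : MonicQuad F // IsCoprime t.2.1.1 t.2.2.1.1}

variable {F}

/-- The degree of a monic polynomial. -/
def MonicPoly.deg (p : MonicPoly F) : ℕ := p.1.natDegree

/-- The total degree of a quadruple of monic polynomials. -/
def MonicQuad.deg (t : MonicQuad F) : ℕ :=
  MonicPoly.deg t.1 + (MonicPoly.deg t.2.1 + (MonicPoly.deg t.2.2.1 + MonicPoly.deg t.2.2.2))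

/-- Monic polynomials of degree `n` correspond to their lower coefficients. -/
noncomputable def monicFiberEquiv (n : ℕ) :
    {p : MonicPoly F // MonicPoly.deg p = n} ≃ (Fin n → F) :=
  (Equiv.subtypeSubtypeEquivSubtypeInter _ fun p : F[X] => p.natDegree = n).trans
    ((monicEquivDegreeLT n).trans (degreeLTEquiv F n).toEquiv)

theorem MonicPoly.deg_mul (p r : MonicPoly F) :
    MonicPoly.deg ⟨p.1 * r.1, p.2.mul r.2⟩ = MonicPoly.deg p + MonicPoly.deg r :=
  p.2.natDegree_mul r.2

/-- Multiplying the two middle entries of a quadruple by a common factor. -/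
noncomputable def mulMiddle (x : MonicPoly F × CoprimeQuad F) : MonicQuad F :=
  (x.2.1.1, ⟨x.1.1 * x.2.1.2.1.1, x.1.2.mul x.2.1.2.1.2⟩,
    ⟨x.1.1 * x.2.1.2.2.1.1, x.1.2.mul x.2.1.2.2.1.2⟩, x.2.1.2.2.2)

theorem deg_mulMiddle (x : MonicPoly F × CoprimeQuad F) :
    MonicQuad.deg (mulMiddle x) = 2 * MonicPoly.deg x.1 + MonicQuad.deg x.2.1 := by
  simp only [MonicQuad.deg, mulMiddle, MonicPoly.deg_mul]
  ring

theorem dvd_of_mul_eq_mul_of_isCoprime {R : Type*} [CommRing R] {g h b c b' c' : R}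
    (hbc : IsCoprime b c) (hb : g * b = h * b') (hc : g * c = h * c') : h ∣ g := by
  obtain ⟨u, v, huv⟩ := hbc
  exact ⟨u * b' + v * c', by linear_combination (-g) * huv + u * hb + v * hc⟩

theorem exists_monic_mul_isCoprime {b c : F[X]} (hb : b.Monic) (hc : c.Monic) :
    ∃ g b' c' : F[X], g.Monic ∧ b'.Monic ∧ c'.Monic ∧ IsCoprime b' c' ∧
      b = g * b' ∧ c = g * c' := by
  classical
  have hg : EuclideanDomain.gcd b c ≠ 0 := fun h =>
    hb.ne_zero (EuclideanDomain.gcd_eq_zero_iff.1 h).1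
  have hd := normalize_associated (EuclideanDomain.gcd b c)
  have hm := monic_normalize hg
  obtain ⟨b', hb'⟩ := hd.dvd.trans (EuclideanDomain.gcd_dvd_left b c)
  obtain ⟨c', hc'⟩ := hd.dvd.trans (EuclideanDomain.gcd_dvd_right b c)
  refine ⟨_, b', c', hm, hm.of_mul_monic_left (hb' ▸ hb), hm.of_mul_monic_left (hc' ▸ hc),
    ?_, hb', hc'⟩
  obtain ⟨u, v, huv⟩ : ∃ u v, u * b + v * c = normalize (EuclideanDomain.gcd b c) := by
    obtain ⟨w, hw⟩ := hd.symm.dvd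
    refine ⟨EuclideanDomain.gcdA b c * w, EuclideanDomain.gcdB b c * w, ?_⟩
    rw [hw]
    linear_combination (-w) * EuclideanDomain.gcd_eq_gcd_ab b c
  refine ⟨u, v, mul_left_cancel₀ hm.ne_zero ?_⟩
  linear_combination huv - u * hb' - v * hc'

theorem mulMiddle_bijective : Function.Bijective (mulMiddle (F := F)) := by
  constructor
  · rintro ⟨⟨g, hg⟩, ⟨⟨a, b, c, d⟩, hbc⟩⟩ ⟨⟨h, hh⟩, ⟨⟨a', b', c', d'⟩, hbc'⟩⟩ heq
    simp only [mulMiddle, Prod.mk.injEq, Subtype.mk.injEq] at heq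
    obtain ⟨rfl, hb, hc, rfl⟩ := heq
    obtain rfl : g = h := eq_of_monic_of_associated hg hh
      (associated_of_dvd_dvd (dvd_of_mul_eq_mul_of_isCoprime hbc' hb.symm hc.symm)
        (dvd_of_mul_eq_mul_of_isCoprime hbc hb hc))
    obtain rfl : b = b' := Subtype.ext (mul_left_cancel₀ hg.ne_zero hb)
    obtain rfl : c = c' := Subtype.ext (mul_left_cancel₀ hg.ne_zero hc)
    rfl
  · rintro ⟨a, ⟨b, hb⟩, ⟨c, hc⟩, d⟩
    obtain ⟨g, b', c', hg, hb', hc', hco, rfl, rfl⟩ := exists_monic_mul_isCoprime hb hc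
    exact ⟨(⟨g, hg⟩, ⟨(a, ⟨b', hb'⟩, ⟨c', hc'⟩, d), hco⟩), rfl⟩

theorem card_doubleFiber_odd (n : ℕ) :
    Nat.card {p : MonicPoly F // 2 * MonicPoly.deg p = 2 * n + 1} = 0 := by
  have : IsEmpty {p : MonicPoly F // 2 * MonicPoly.deg p = 2 * n + 1} :=
    ⟨fun p => by have := p.2; omega⟩
  exact Nat.card_of_isEmpty

variable [Fintype F]

theorem finite_monicFiber (n : ℕ) : Finite {p : MonicPoly F // MonicPoly.deg p = n} :=
  Finite.of_equiv _ (monicFiberEquiv n).symm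

theorem card_monicFiber (n : ℕ) :
    Nat.card {p : MonicPoly F // MonicPoly.deg p = n} = Fintype.card F ^ n := by
  rw [Nat.card_congr (monicFiberEquiv n)]
  simp

theorem finite_monicQuadFiber (n : ℕ) : Finite {t : MonicQuad F // MonicQuad.deg t = n} :=
  finite_fiber_add finite_monicFiber
    (finite_fiber_add finite_monicFiber
      (finite_fiber_add finite_monicFiber finite_monicFiber)) n

theorem card_monicQuadFiber (n : ℕ) :
    Nat.card {t : MonicQuad F // MonicQuad.deg t = n} =
      Fintype.card F ^ n * (n + 3).choose 3 := by
  have h2 := finite_fiber_add (finite_monicFiber (F := F)) (finite_monicFiber (F := F))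
  have h3 := finite_fiber_add (finite_monicFiber (F := F)) h2
  refine card_fiber_add_eq_choose finite_monicFiber h3 card_monicFiber
    (card_fiber_add_eq_choose finite_monicFiber h2 card_monicFiber
      (card_fiber_add_eq_choose (r := 0) finite_monicFiber finite_monicFiber card_monicFiber
        fun n => ?_)) n
  simpa using card_monicFiber n

theorem finite_coprimeQuadFiber (n : ℕ) :
    Finite {t : CoprimeQuad F // MonicQuad.deg t.1 = n} :=
  have := finite_monicQuadFiber (F := F) n
  Finite.of_injective
    (fun t => (⟨t.1.1, t.2⟩ : {t : MonicQuad F // MonicQuad.deg t = n}))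
    fun _ _ h => Subtype.ext (Subtype.ext (Subtype.mk.inj h))

theorem finite_doubleFiber (n : ℕ) : Finite {p : MonicPoly F // 2 * MonicPoly.deg p = n} :=
  have := finite_monicFiber (F := F) (n / 2)
  Finite.of_injective
    (fun p => (⟨p.1, by have := p.2; omega⟩ : {p : MonicPoly F // MonicPoly.deg p = n / 2}))
    fun _ _ h => Subtype.ext (Subtype.mk.inj h)

theorem card_doubleFiber_even (n : ℕ) :
    Nat.card {p : MonicPoly F // 2 * MonicPoly.deg p = 2 * n} = Fintype.card F ^ n := by
  rw [← card_monicFiber]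
  exact Nat.card_congr (Equiv.subtypeEquivRight fun p => by omega)

theorem card_doubleFiber_add_two (n : ℕ) :
    Nat.card {p : MonicPoly F // 2 * MonicPoly.deg p = n + 1 + 1} =
      Fintype.card F * Nat.card {p : MonicPoly F // 2 * MonicPoly.deg p = n} := by
  obtain ⟨k, rfl | rfl⟩ := Nat.even_or_odd' n
  · rw [card_doubleFiber_even, ← pow_succ', ← card_doubleFiber_even]
    rfl
  · rw [card_doubleFiber_odd, mul_zero]
    exact card_doubleFiber_odd (k + 1)

theorem card_monicQuadFiber_eq_sum (n : ℕ) :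
    Nat.card {t : MonicQuad F // MonicQuad.deg t = n} =
      ∑ p ∈ Finset.HasAntidiagonal.antidiagonal n,
        Nat.card {g : MonicPoly F // 2 * MonicPoly.deg g = p.1} *
        Nat.card {t : CoprimeQuad F // MonicQuad.deg t.1 = p.2} := by
  rw [← card_fiber_add finite_doubleFiber finite_coprimeQuadFiber]
  exact (Nat.card_congr ((Equiv.ofBijective _ mulMiddle_bijective).subtypeEquiv fun x => by
    rw [Equiv.ofBijective_apply, deg_mulMiddle])).symm

theorem card_coprimeQuadFiber_one :
    Nat.card {t : CoprimeQuad F // MonicQuad.deg t.1 = 1} = Fintype.card F * 4 := by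
  have h := card_monicQuadFiber_eq_sum (F := F) 1
  have h0 := card_doubleFiber_even (F := F) 0
  have h1 := card_doubleFiber_odd (F := F) 0
  simp only [mul_zero, zero_add] at h0 h1
  rw [card_monicQuadFiber, Finset.Nat.sum_antidiagonal_succ] at h
  simp only [Finset.Nat.antidiagonal_zero, Finset.sum_singleton, zero_add, h0, h1] at h
  simpa [Nat.choose] using h.symm

theorem card_coprimeQuadFiber_add_two (n : ℕ) :
    Nat.card {t : CoprimeQuad F // MonicQuad.deg t.1 = n + 2} +
        Fintype.card F ^ (n + 1) * (n + 3).choose 3 =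
      Fintype.card F ^ (n + 2) * (n + 5).choose 3 := by
  have h := card_monicQuadFiber_eq_sum (F := F) (n + 1 + 1)
  have h0 := card_doubleFiber_even (F := F) 0
  have h1 := card_doubleFiber_odd (F := F) 0
  simp only [mul_zero, zero_add] at h0 h1
  rw [Finset.Nat.sum_antidiagonal_succ, Finset.Nat.sum_antidiagonal_succ] at h
  simp only [zero_add, h0, h1, card_doubleFiber_add_two, mul_assoc] at h
  rw [← Finset.mul_sum, ← card_monicQuadFiber_eq_sum, card_monicQuadFiber,
    card_monicQuadFiber] at h
  rw [pow_succ' _ n, mul_assoc]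
  simpa using h.symm

end MonicPolynomial

theorem choose_add_five_three (n : ℕ) :
    (n + 5).choose 3 = (n + 3).choose 3 + (n + 3) ^ 2 := by
  have h1 := Nat.choose_succ_succ (n + 4) 2
  have h2 := Nat.choose_succ_succ (n + 3) 2
  have h3 := Nat.choose_succ_succ (n + 3) 1
  have h4 := Nat.triangle_succ (n + 2)
  have h5 : (n + 3).choose 2 * 2 = (n + 3) * (n + 2) := by
    rw [Nat.choose_two_right]
    exact Nat.div_mul_cancel (Nat.even_mul_pred_self (n + 3)).two_dvd
  simp only [Nat.succ_eq_add_one, Nat.reduceAdd, add_assoc, Nat.choose_one_right] at h1 h2 h3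
  nlinarith

theorem ncard_eq_card_coprimeQuadFiber {F : Type*} [Field F] (m : ℕ) :
    Set.ncard {t : F[X] × F[X] × F[X] × F[X] |
        t.1.Monic ∧ t.1.natDegree ≤ m ∧
        t.2.1.Monic ∧ t.2.1.natDegree ≤ m ∧
        t.2.2.1.Monic ∧ t.2.2.1.natDegree ≤ m ∧
        t.2.2.2.Monic ∧ t.2.2.2.natDegree ≤ m ∧
        IsCoprime t.2.1 t.2.2.1 ∧
        (t.1 * t.2.1 * t.2.2.1 * t.2.2.2).natDegree = m} =
      Nat.card {t : CoprimeQuad F // MonicQuad.deg t.1 = m} := by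
  have key {a b c d : F[X]} (ha : a.Monic) (hb : b.Monic) (hc : c.Monic) (hd : d.Monic) :
      (a * b * c * d).natDegree =
        a.natDegree + (b.natDegree + (c.natDegree + d.natDegree)) := by
    rw [((ha.mul hb).mul hc).natDegree_mul hd, (ha.mul hb).natDegree_mul hc,
      ha.natDegree_mul hb]
    ring
  rw [← Nat.card_coe_set_eq]
  refine Nat.card_congr
    { toFun := fun t => ⟨⟨(⟨t.1.1, t.2.1⟩, ⟨t.1.2.1, t.2.2.2.1⟩, ⟨t.1.2.2.1, t.2.2.2.2.2.1⟩,
        ⟨t.1.2.2.2, t.2.2.2.2.2.2.2.1⟩), t.2.2.2.2.2.2.2.2.2.1⟩, ?_⟩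
      invFun := fun t => ⟨(t.1.1.1.1, t.1.1.2.1.1, t.1.1.2.2.1.1, t.1.1.2.2.2.1), ?_⟩
      left_inv := fun _ => rfl
      right_inv := fun _ => rfl }
  · obtain ⟨_, ha, -, hb, -, hc, -, hd, -, -, h⟩ := t
    exact (key ha hb hc hd).symm.trans h
  · obtain ⟨⟨⟨⟨a, ha⟩, ⟨b, hb⟩, ⟨c, hc⟩, ⟨d, hd⟩⟩, hbc⟩, h⟩ := t
    simp only [MonicQuad.deg, MonicPoly.deg] at h
    exact ⟨ha, by dsimp only; omega, hb, by dsimp only; omega, hc, by dsimp only; omega,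
      hd, by dsimp only; omega, hbc, (key ha hb hc hd).trans h⟩

/-- Lemma 8: for a positive integer `m`,
`S_m = {(a,b,c,d) ∈ P_m⁴ : gcd(b,c) = 1, deg(a·b·c·d) = m}` has size
`q^m · (((q−1)/q)·C(m+1,3) + (m+1)²)`. -/
theorem card_S_m {F : Type} [Field F] [Fintype F] (m : ℕ) (hm : 0 < m) :
    (Set.ncard {t : F[X] × F[X] × F[X] × F[X] |
        t.1.Monic ∧ t.1.natDegree ≤ m ∧
        t.2.1.Monic ∧ t.2.1.natDegree ≤ m ∧
        t.2.2.1.Monic ∧ t.2.2.1.natDegree ≤ m ∧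
        t.2.2.2.Monic ∧ t.2.2.2.natDegree ≤ m ∧
        IsCoprime t.2.1 t.2.2.1 ∧
        (t.1 * t.2.1 * t.2.2.1 * t.2.2.2).natDegree = m} : ℝ) =
      (Fintype.card F : ℝ) ^ m *
        ((((Fintype.card F : ℝ) - 1) / (Fintype.card F : ℝ)) * ((m + 1).choose 3 : ℝ) +
          ((m : ℝ) + 1) ^ 2) := by
  rw [ncard_eq_card_coprimeQuadFiber]
  have hq : (Fintype.card F : ℝ) ≠ 0 := Nat.cast_ne_zero.2 Fintype.card_ne_zero
  obtain _ | _ | n := m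
  · exact absurd hm (lt_irrefl 0)
  · rw [zero_add, card_coprimeQuadFiber_one]
    norm_num [Nat.choose]
  · have h : ((_ : ℕ) : ℝ) = _ := congrArg Nat.cast (card_coprimeQuadFiber_add_two (F := F) n)
    rw [choose_add_five_three] at h
    push_cast at h ⊢
    rw [show n + 1 + 1 + 1 = n + 3 from rfl, show n + 1 + 1 = n + 2 from rfl]
    rw [eq_sub_of_add_eq h]
    field_simp
    ring
end

section
/- For a positive integer n, let S_n* = {(a, b, c, d) ∈ P_n⁴ : gcd(b, c) = 1 and each of the products a·b, c·d, a·c, b·d has degree at most n}. Then |S_n*| = (n + 1)·q^{2n+1}·(q + 1)/(q − 1)² − (q^{n+1} − 1)·(3·q^{n+1} − 1)/(q − 1)³. -/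
open Polynomial

/-- Monic polynomials of degree at most `m`. -/
def monicDegLE (F : Type*) [Field F] (m : ℕ) : Set F[X] :=
  {p | p.Monic ∧ p.natDegree ≤ m}

/-- Coprime pairs of monic polynomials of degree at most `m`. -/
def coprimePairs (F : Type*) [Field F] (m : ℕ) : Set (F[X] × F[X]) :=
  {p | p.1 ∈ monicDegLE F m ∧ p.2 ∈ monicDegLE F m ∧ IsCoprime p.1 p.2}

/-- Triples `(h, b, c)` of monic polynomials, `b` and `c` coprime, `h * b` and `h * c` of degree
at most `m`. These parametrize pairs of monic polynomials by their gcd and cofactors. -/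
def gcdTriples (F : Type*) [Field F] (m : ℕ) : Set (F[X] × F[X] × F[X]) :=
  {t | t.1.Monic ∧ t.2.1.Monic ∧ t.2.2.Monic ∧ IsCoprime t.2.1 t.2.2 ∧
    t.1.natDegree + t.2.1.natDegree ≤ m ∧ t.1.natDegree + t.2.2.natDegree ≤ m}

section

variable {F : Type*} [Field F]

theorem monic_mul_X_add_C {p : F[X]} (hp : p.Monic) (e : F) : (p * X + C e).Monic := by
  refine (hp.mul monic_X).add_of_left (degree_C_le.trans_lt ?_)
  rw [← natDegree_pos_iff_degree_pos, hp.natDegree_mul monic_X, natDegree_X]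
  omega

theorem natDegree_mul_X_add_C {p : F[X]} (hp : p.Monic) (e : F) :
    (p * X + C e).natDegree = p.natDegree + 1 := by
  rw [natDegree_add_C, hp.natDegree_mul monic_X, natDegree_X]

theorem mul_X_add_C_inj {p r : F[X]} {e f : F} :
    p * X + C e = r * X + C f ↔ p = r ∧ e = f := by
  refine ⟨fun h ↦ ?_, fun ⟨h, h'⟩ ↦ by rw [h, h']⟩
  obtain rfl : e = f := by simpa using congrArg (coeff · 0) h
  exact ⟨mul_right_cancel₀ X_ne_zero (add_right_cancel h), rfl⟩

theorem exists_monic_mul_X_add_C {p : F[X]} (hp : p.Monic) (h : p.natDegree ≠ 0) :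
    ∃ r : F[X], ∃ e : F, r.Monic ∧ p = r * X + C e := by
  refine ⟨p.divX, p.coeff 0, ?_, (divX_mul_X_add p).symm⟩
  have h1 : p.divX.natDegree = p.natDegree - 1 := natDegree_divX_eq_natDegree_tsub_one
  rw [Monic, leadingCoeff, h1, coeff_divX, Nat.sub_add_cancel (Nat.pos_of_ne_zero h)]
  exact hp

theorem monicDegLE_zero : monicDegLE F 0 = {1} := by
  ext p
  simp only [monicDegLE, Set.mem_ofPred_eq, Set.mem_singleton_iff, Nat.le_zero]
  exact ⟨fun h ↦ h.1.natDegree_eq_zero.1 h.2, fun h ↦ by simp [h]⟩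

theorem monicDegLE_succ (m : ℕ) :
    monicDegLE F (m + 1) =
      insert 1 ((fun x : F[X] × F ↦ x.1 * X + C x.2) '' (monicDegLE F m ×ˢ Set.univ)) := by
  ext p
  simp only [monicDegLE, Set.mem_ofPred_eq, Set.mem_insert_iff, Set.mem_image, Set.mem_prod,
    Set.mem_univ, and_true, Prod.exists]
  constructor
  · rintro ⟨hp, hd⟩
    by_cases h0 : p.natDegree = 0
    · exact .inl (hp.natDegree_eq_zero.1 h0)
    · obtain ⟨r, e, hr, rfl⟩ := exists_monic_mul_X_add_C hp h0
      rw [natDegree_mul_X_add_C hr] at hd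
      exact .inr ⟨r, e, ⟨hr, by omega⟩, rfl⟩
  · rintro (rfl | ⟨r, e, ⟨hr, hd⟩, rfl⟩)
    · simp
    · exact ⟨monic_mul_X_add_C hr e, by rw [natDegree_mul_X_add_C hr]; omega⟩

theorem bijOn_gcdTriples (m : ℕ) :
    Set.BijOn (fun t : F[X] × F[X] × F[X] ↦ (t.1 * t.2.1, t.1 * t.2.2)) (gcdTriples F m)
      (monicDegLE F m ×ˢ monicDegLE F m) := by
  refine ⟨?_, ?_, ?_⟩
  · rintro ⟨h, b, c⟩ ⟨hh, hb, hc, -, h1, h2⟩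
    exact ⟨⟨hh.mul hb, by simpa [hh.natDegree_mul hb] using h1⟩,
      ⟨hh.mul hc, by simpa [hh.natDegree_mul hc] using h2⟩⟩
  · have dvd : ∀ {h b c h' b' c' : F[X]}, IsCoprime b' c' → h * b = h' * b' → h * c = h' * c' →
        h ∣ h' := by
      rintro h b c h' b' c' ⟨u, v, huv⟩ e1 e2
      exact ⟨u * b + v * c, by linear_combination (-h') * huv - u * e1 - v * e2⟩
    rintro ⟨h, b, c⟩ ⟨hh, -, -, hbc, -⟩ ⟨h', b', c'⟩ ⟨hh', -, -, hbc', -⟩ heq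
    obtain ⟨e1, e2⟩ := Prod.mk.inj heq
    dsimp only at *
    obtain rfl : h = h' := eq_of_monic_of_associated hh hh'
      (associated_of_dvd_dvd (dvd hbc' e1 e2) (dvd hbc e1.symm e2.symm))
    rw [mul_left_cancel₀ hh.ne_zero e1, mul_left_cancel₀ hh.ne_zero e2]
  · rintro ⟨b, c⟩ ⟨⟨hb, hb'⟩, hc, hc'⟩
    dsimp only at *
    classical
    have hg0 : EuclideanDomain.gcd b c ≠ 0 := fun h ↦
      hb.ne_zero (EuclideanDomain.gcd_eq_zero_iff.1 h).1
    have hassoc := normalize_associated (EuclideanDomain.gcd b c)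
    have hh : (normalize (EuclideanDomain.gcd b c)).Monic := monic_normalize hg0
    obtain ⟨b', eb⟩ := hassoc.dvd.trans (EuclideanDomain.gcd_dvd_left b c)
    obtain ⟨c', ec⟩ := hassoc.dvd.trans (EuclideanDomain.gcd_dvd_right b c)
    have hbez : normalize (EuclideanDomain.gcd b c) ∈ Ideal.span {b, c} := by
      rw [← Ideal.span_singleton_le_iff_mem, ← EuclideanDomain.span_gcd]
      exact Ideal.span_singleton_le_span_singleton.2 hassoc.symm.dvd
    generalize normalize (EuclideanDomain.gcd b c) = h at *
    obtain ⟨u, v, huv⟩ := Ideal.mem_span_pair.1 hbez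
    have mb : b'.Monic := hh.of_mul_monic_left (eb ▸ hb)
    have mc : c'.Monic := hh.of_mul_monic_left (ec ▸ hc)
    refine ⟨(h, b', c'), ⟨hh, mb, mc, ⟨u, v, mul_left_cancel₀ hh.ne_zero ?_⟩, ?_, ?_⟩, ?_⟩
    · linear_combination huv - u * eb - v * ec
    · rwa [eb, hh.natDegree_mul mb] at hb'
    · rwa [ec, hh.natDegree_mul mc] at hc'
    · simp [eb, ec]

theorem gcdTriples_succ (m : ℕ) :
    gcdTriples F (m + 1) = Prod.mk 1 '' coprimePairs F (m + 1) ∪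
      (fun x : (F[X] × F[X] × F[X]) × F ↦ (x.1.1 * X + C x.2, x.1.2)) ''
        (gcdTriples F m ×ˢ Set.univ) := by
  ext ⟨h, b, c⟩
  constructor
  · rintro ⟨hh, hb, hc, hbc, h1, h2⟩
    dsimp only at *
    by_cases h0 : h.natDegree = 0
    · obtain rfl := hh.natDegree_eq_zero.1 h0
      exact .inl ⟨(b, c), ⟨⟨hb, by simpa using h1⟩, ⟨hc, by simpa using h2⟩, hbc⟩, rfl⟩
    · obtain ⟨r, e, hr, rfl⟩ := exists_monic_mul_X_add_C hh h0
      rw [natDegree_mul_X_add_C hr] at h1 h2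
      exact .inr ⟨((r, b, c), e), ⟨⟨hr, hb, hc, hbc, by dsimp only; omega, by dsimp only; omega⟩,
        trivial⟩, rfl⟩
  · rintro (⟨⟨b, c⟩, ⟨⟨hb, h1⟩, ⟨hc, h2⟩, hbc⟩, ⟨⟩⟩ | ⟨⟨⟨r, b, c⟩, e⟩,
      ⟨⟨hr, hb, hc, hbc, h1, h2⟩, -⟩, ⟨⟩⟩)
    · exact ⟨monic_one, hb, hc, hbc, by simpa using h1, by simpa using h2⟩
    · dsimp only at *
      refine ⟨monic_mul_X_add_C hr e, hb, hc, hbc, ?_, ?_⟩ <;> dsimp only <;>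
        rw [natDegree_mul_X_add_C hr] <;> omega

theorem ncard_monicDegLE_zero : (monicDegLE F 0).ncard = 1 := by
  rw [monicDegLE_zero, Set.ncard_singleton]

theorem coprimePairs_zero : coprimePairs F 0 = {(1, 1)} := by
  ext ⟨b, c⟩
  simp only [coprimePairs, monicDegLE_zero, Set.mem_ofPred_eq, Set.mem_singleton_iff, Prod.mk.injEq]
  exact ⟨fun h ↦ ⟨h.1, h.2.1⟩, fun ⟨h, h'⟩ ↦ ⟨h, h', h ▸ isCoprime_one_left⟩⟩

theorem coprimePairs_mono {m k : ℕ} (h : m ≤ k) : coprimePairs F m ⊆ coprimePairs F k :=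
  fun _ ⟨h1, h2, h3⟩ ↦ ⟨⟨h1.1, h1.2.trans h⟩, ⟨h2.1, h2.2.trans h⟩, h3⟩

theorem ncard_gcdTriples (m : ℕ) : (gcdTriples F m).ncard = (monicDegLE F m).ncard ^ 2 := by
  rw [← (bijOn_gcdTriples m).injOn.ncard_image, (bijOn_gcdTriples m).image_eq,
    Set.ncard_prod, sq]

/-- Quadruples `((b, c), (a, d))` of monic polynomials, `b` and `c` coprime of degree at most `k`,
with `max (deg b) (deg c) + max (deg a) (deg d) ≤ n`. -/
def truncatedQuadruples (F : Type*) [Field F] (n k : ℕ) :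
    Set ((F[X] × F[X]) × (F[X] × F[X])) :=
  {t | t.1 ∈ coprimePairs F k ∧ t.2.1.Monic ∧ t.2.2.Monic ∧
    max t.1.1.natDegree t.1.2.natDegree + max t.2.1.natDegree t.2.2.natDegree ≤ n}

theorem truncatedQuadruples_zero (n : ℕ) : truncatedQuadruples F n 0 =
    coprimePairs F 0 ×ˢ (monicDegLE F n ×ˢ monicDegLE F n) := by
  ext ⟨⟨b, c⟩, a, d⟩
  simp only [truncatedQuadruples, coprimePairs, monicDegLE, Set.mem_ofPred_eq, Set.mem_prod]
  grind

theorem truncatedQuadruples_succ {n k : ℕ} (hk : k + 1 ≤ n) :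
    truncatedQuadruples F n (k + 1) = truncatedQuadruples F n k ∪
      (coprimePairs F (k + 1) \ coprimePairs F k) ×ˢ
        (monicDegLE F (n - (k + 1)) ×ˢ monicDegLE F (n - (k + 1))) := by
  ext ⟨⟨b, c⟩, a, d⟩
  simp only [truncatedQuadruples, coprimePairs, monicDegLE, Set.mem_ofPred_eq, Set.mem_prod,
    Set.mem_union, Set.mem_sdiff]
  grind

theorem ncard_truncatedQuadruples_zero (n : ℕ) :
    (truncatedQuadruples F n 0).ncard = (monicDegLE F n).ncard ^ 2 := by
  rw [truncatedQuadruples_zero, Set.ncard_prod, Set.ncard_prod, coprimePairs_zero,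
    Set.ncard_singleton, one_mul, sq]

variable [Fintype F]

theorem finite_monicDegLE (m : ℕ) : (monicDegLE F m).Finite := by
  induction m with
  | zero => rw [monicDegLE_zero]; exact Set.finite_singleton 1
  | succ m ih => rw [monicDegLE_succ]; exact ((ih.prod Set.finite_univ).image _).insert 1

theorem finite_coprimePairs (m : ℕ) : (coprimePairs F m).Finite :=
  ((finite_monicDegLE m).prod (finite_monicDegLE m)).subset fun _ h ↦ ⟨h.1, h.2.1⟩

theorem finite_gcdTriples (m : ℕ) : (gcdTriples F m).Finite :=
  (bijOn_gcdTriples m).finite_iff_finite.2 ((finite_monicDegLE m).prod (finite_monicDegLE m))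

theorem ncard_monicDegLE_succ (m : ℕ) :
    (monicDegLE F (m + 1)).ncard = Fintype.card F * (monicDegLE F m).ncard + 1 := by
  rw [monicDegLE_succ, Set.ncard_insert_of_notMem _
    (((finite_monicDegLE m).prod Set.finite_univ).image _), Set.ncard_image_of_injective,
    Set.ncard_prod, Set.ncard_univ, Nat.card_eq_fintype_card, mul_comm]
  · rintro ⟨p, e⟩ ⟨r, f⟩ h
    exact Prod.ext_iff.2 (mul_X_add_C_inj.1 h)
  · rintro ⟨⟨p, e⟩, ⟨⟨hp, -⟩, -⟩, h⟩
    simpa [natDegree_mul_X_add_C hp] using congrArg natDegree h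

theorem ncard_monicDegLE_mul (m : ℕ) :
    ((monicDegLE F m).ncard : ℝ) * (Fintype.card F - 1) = (Fintype.card F : ℝ) ^ (m + 1) - 1 := by
  induction m with
  | zero => simp [ncard_monicDegLE_zero]
  | succ m ih =>
    rw [ncard_monicDegLE_succ]
    push_cast
    linear_combination (Fintype.card F : ℝ) * ih

theorem ncard_coprimePairs_succ (m : ℕ) :
    (coprimePairs F (m + 1)).ncard + Fintype.card F * (monicDegLE F m).ncard ^ 2 =
      (monicDegLE F (m + 1)).ncard ^ 2 := by
  rw [← ncard_gcdTriples, ← ncard_gcdTriples, gcdTriples_succ, Set.ncard_union_eq _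
    ((finite_coprimePairs _).image _) (((finite_gcdTriples m).prod Set.finite_univ).image _),
    Set.ncard_image_of_injective _ (Prod.mk_right_injective 1), Set.ncard_image_of_injective,
    Set.ncard_prod, Set.ncard_univ, Nat.card_eq_fintype_card, mul_comm]
  · rintro ⟨⟨p, x⟩, e⟩ ⟨⟨r, y⟩, f⟩ h
    obtain ⟨h1, h2⟩ := Prod.mk.inj h
    obtain ⟨rfl, rfl⟩ := mul_X_add_C_inj.1 h1
    obtain rfl : x = y := h2
    rfl
  · rw [Set.disjoint_left]
    rintro _ ⟨p, -, rfl⟩ ⟨⟨⟨r, x⟩, e⟩, ⟨⟨hr, -⟩, -⟩, h⟩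
    simpa [natDegree_mul_X_add_C hr] using congrArg natDegree (Prod.mk.inj h).1

theorem ncard_coprimePairs_mul (m : ℕ) :
    ((coprimePairs F m).ncard : ℝ) * (Fintype.card F - 1) =
      (Fintype.card F : ℝ) ^ (2 * m + 1) - 1 := by
  have hq : (Fintype.card F : ℝ) - 1 ≠ 0 :=
    sub_ne_zero.2 (by exact_mod_cast (Fintype.one_lt_card (α := F)).ne')
  cases m with
  | zero => simp [coprimePairs_zero]
  | succ m =>
    have h := congrArg (Nat.cast : ℕ → ℝ) (ncard_coprimePairs_succ (F := F) m)
    have h1 := ncard_monicDegLE_mul (F := F) m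
    have h2 := ncard_monicDegLE_mul (F := F) (m + 1)
    push_cast at h
    apply mul_right_cancel₀ hq
    generalize (Fintype.card F : ℝ) = q at *
    generalize ((monicDegLE F m).ncard : ℝ) = s at *
    generalize ((monicDegLE F (m + 1)).ncard : ℝ) = t at *
    linear_combination (q - 1) ^ 2 * h + (t * (q - 1) + (q ^ (m + 1 + 1) - 1)) * h2 -
      q * (s * (q - 1) + (q ^ (m + 1) - 1)) * h1

theorem finite_truncatedQuadruples (n k : ℕ) : (truncatedQuadruples F n k).Finite := by
  refine ((finite_coprimePairs k).prod ((finite_monicDegLE n).prod (finite_monicDegLE n))).subset ?_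
  rintro ⟨⟨b, c⟩, a, d⟩ ⟨h, ha, hd, hle⟩
  dsimp only at hle
  exact ⟨h, ⟨ha, by grind⟩, ⟨hd, by grind⟩⟩

theorem ncard_truncatedQuadruples_succ {n k : ℕ} (hk : k + 1 ≤ n) :
    ((truncatedQuadruples F n (k + 1)).ncard : ℝ) = (truncatedQuadruples F n k).ncard +
      ((coprimePairs F (k + 1)).ncard - (coprimePairs F k).ncard) *
        ((monicDegLE F (n - (k + 1))).ncard : ℝ) ^ 2 := by
  have hfin := finite_monicDegLE (F := F) (n - (k + 1))
  rw [truncatedQuadruples_succ hk, Set.ncard_union_eq _ (finite_truncatedQuadruples n k)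
    ((finite_coprimePairs (k + 1)).sdiff.prod (hfin.prod hfin)), Set.ncard_prod, Set.ncard_prod,
    Nat.cast_add, Nat.cast_mul, Set.cast_ncard_sdiff (coprimePairs_mono k.le_succ)
    (finite_coprimePairs _)]
  · push_cast
    ring
  · rw [Set.disjoint_left]
    exact fun _ h h' ↦ h'.1.2 h.1

theorem ncard_truncatedQuadruples_mul {n k : ℕ} (hk : k ≤ n) :
    ((truncatedQuadruples F n k).ncard : ℝ) * (Fintype.card F * (Fintype.card F - 1) ^ 3) =
      Fintype.card F * (Fintype.card F - 1) * ((Fintype.card F : ℝ) ^ (n + 1) - 1) ^ 2 +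
      ((Fintype.card F : ℝ) ^ 2 - 1) * k * ((Fintype.card F : ℝ) ^ (n + 1)) ^ 2 -
      2 * (Fintype.card F : ℝ) ^ (n + 1) * Fintype.card F * (Fintype.card F + 1) *
        ((Fintype.card F : ℝ) ^ k - 1) +
      (Fintype.card F : ℝ) ^ 2 * (((Fintype.card F : ℝ) ^ k) ^ 2 - 1) := by
  induction k with
  | zero =>
    have h := ncard_monicDegLE_mul (F := F) n
    rw [ncard_truncatedQuadruples_zero]
    push_cast
    rw [← h]
    ring
  | succ k ih =>
    have hT := ncard_monicDegLE_mul (F := F) (n - (k + 1))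
    have hB := ncard_coprimePairs_mul (F := F) k
    have hB' := ncard_coprimePairs_mul (F := F) (k + 1)
    have hQ : (Fintype.card F : ℝ) ^ (n + 1) =
        (Fintype.card F : ℝ) ^ (k + 1) * (Fintype.card F : ℝ) ^ (n - (k + 1) + 1) := by
      rw [← pow_add]
      congr 1
      omega
    have ih := ih (by omega)
    rw [ncard_truncatedQuadruples_succ hk, add_mul, ih]
    generalize (Fintype.card F : ℝ) = q at *
    generalize ((monicDegLE F (n - (k + 1))).ncard : ℝ) = t at *
    generalize ((coprimePairs F k).ncard : ℝ) = b at *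
    generalize ((coprimePairs F (k + 1)).ncard : ℝ) = b' at *
    have hmul : (b' - b) * t ^ 2 * (q * (q - 1) ^ 3) =
        q * (b' * (q - 1) - b * (q - 1)) * (t * (q - 1)) ^ 2 := by ring
    rw [hmul, hT, hB, hB', hQ]
    push_cast
    ring

end

/-- Lemma 9: for a positive integer `n`,
`S_n* = {(a,b,c,d) ∈ P_n⁴ : gcd(b,c) = 1, and a·b, c·d, a·c, b·d all have degree ≤ n}`
has size `(n+1)·q^{2n+1}·(q+1)/(q−1)² − (q^{n+1}−1)·(3·q^{n+1}−1)/(q−1)³`. -/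
theorem card_S_n_star {F : Type} [Field F] [Fintype F] (n : ℕ) (hn : 0 < n) :
    (Set.ncard {t : F[X] × F[X] × F[X] × F[X] |
        t.1.Monic ∧ t.1.natDegree ≤ n ∧
        t.2.1.Monic ∧ t.2.1.natDegree ≤ n ∧
        t.2.2.1.Monic ∧ t.2.2.1.natDegree ≤ n ∧
        t.2.2.2.Monic ∧ t.2.2.2.natDegree ≤ n ∧
        IsCoprime t.2.1 t.2.2.1 ∧
        (t.1 * t.2.1).natDegree ≤ n ∧ (t.2.2.1 * t.2.2.2).natDegree ≤ n ∧
        (t.1 * t.2.2.1).natDegree ≤ n ∧ (t.2.1 * t.2.2.2).natDegree ≤ n} : ℝ) =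
      ((n : ℝ) + 1) * (Fintype.card F : ℝ) ^ (2 * n + 1) * ((Fintype.card F : ℝ) + 1) /
          ((Fintype.card F : ℝ) - 1) ^ 2 -
        ((Fintype.card F : ℝ) ^ (n + 1) - 1) * (3 * (Fintype.card F : ℝ) ^ (n + 1) - 1) /
          ((Fintype.card F : ℝ) - 1) ^ 3 := by
  have hset : {t : F[X] × F[X] × F[X] × F[X] |
        t.1.Monic ∧ t.1.natDegree ≤ n ∧
        t.2.1.Monic ∧ t.2.1.natDegree ≤ n ∧
        t.2.2.1.Monic ∧ t.2.2.1.natDegree ≤ n ∧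
        t.2.2.2.Monic ∧ t.2.2.2.natDegree ≤ n ∧
        IsCoprime t.2.1 t.2.2.1 ∧
        (t.1 * t.2.1).natDegree ≤ n ∧ (t.2.2.1 * t.2.2.2).natDegree ≤ n ∧
        (t.1 * t.2.2.1).natDegree ≤ n ∧ (t.2.1 * t.2.2.2).natDegree ≤ n} =
      (fun s : (F[X] × F[X]) × (F[X] × F[X]) ↦ (s.2.1, s.1.1, s.1.2, s.2.2)) ''
        truncatedQuadruples F n n := by
    ext ⟨a, b, c, d⟩
    constructor
    · rintro ⟨ha, ha', hb, hb', hc, hc', hd, hd', hbc, h1, h2, h3, h4⟩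
      dsimp only at *
      rw [ha.natDegree_mul hb] at h1
      rw [hc.natDegree_mul hd] at h2
      rw [ha.natDegree_mul hc] at h3
      rw [hb.natDegree_mul hd] at h4
      exact ⟨((b, c), (a, d)), ⟨⟨⟨hb, hb'⟩, ⟨hc, hc'⟩, hbc⟩, ha, hd, by dsimp only; omega⟩, rfl⟩
    · rintro ⟨⟨⟨b, c⟩, a, d⟩, ⟨⟨⟨hb, hb'⟩, ⟨hc, hc'⟩, hbc⟩, ha, hd, hle⟩, ⟨⟩⟩
      dsimp only at *
      refine ⟨ha, ?_, hb, hb', hc, hc', hd, ?_, hbc, ?_, ?_, ?_, ?_⟩ <;> dsimp only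
      · omega
      · omega
      · rw [ha.natDegree_mul hb]; omega
      · rw [hc.natDegree_mul hd]; omega
      · rw [ha.natDegree_mul hc]; omega
      · rw [hb.natDegree_mul hd]; omega
  have hinj : Function.Injective
      (fun s : (F[X] × F[X]) × (F[X] × F[X]) ↦ (s.2.1, s.1.1, s.1.2, s.2.2)) := by
    rintro ⟨⟨b, c⟩, a, d⟩ ⟨⟨b', c'⟩, a', d'⟩ ⟨⟩
    rfl
  rw [hset, Set.ncard_image_of_injective _ hinj]
  have h := ncard_truncatedQuadruples_mul (F := F) (le_refl n)
  have hq : (Fintype.card F : ℝ) - 1 ≠ 0 :=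
    sub_ne_zero.2 (by exact_mod_cast (Fintype.one_lt_card (α := F)).ne')
  have hq0 : (Fintype.card F : ℝ) ≠ 0 := by exact_mod_cast Fintype.card_ne_zero
  apply mul_right_cancel₀ (mul_ne_zero hq0 (pow_ne_zero 3 hq))
  rw [h]
  field_simp
  ring
end

section
/- For a positive integer n, let X_n* be the set of 8-tuples (f₁, …, f₈) ∈ P_n⁸ such that each of the six products f₁f₂f₃f₄, f₅f₆f₇f₈, f₁f₂f₅f₆, f₃f₄f₇f₈, f₁f₃f₅f₇, f₂f₄f₆f₈ has degree at most n, and gcd(f₃f₄, f₅f₆) = gcd(f₂f₄, f₅f₇) = gcd(f₂, f₃) = gcd(f₆, f₇) = 1. Then there exists an absolute constant C > 0 (independent of q and n) such that |X_n*| ≤ C·n⁴·q^{2n} for every prime power q and every positive integer n. -/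
open Polynomial

theorem Polynomial.exists_finset_monic_natDegree_eq (F : Type*) [Field F] [Fintype F] (d : ℕ) :
    ∃ M : Finset F[X], (∀ p, p.Monic ∧ p.natDegree = d → p ∈ M) ∧
      M.card ≤ Fintype.card F ^ d := by
  classical
  refine ⟨(Finset.univ : Finset (Fin d → F)).image
    (fun c => X ^ d + ∑ i : Fin d, C (c i) * X ^ (i : ℕ)), ?_, ?_⟩
  · rintro p ⟨hp, rfl⟩
    refine Finset.mem_image.2 ⟨fun i => p.coeff i, Finset.mem_univ _, ?_⟩
    conv_rhs => rw [hp.as_sum]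
    rw [Fin.sum_univ_eq_sum_range (fun i => C (p.coeff i) * X ^ i)]
  · exact Finset.card_image_le.trans (by simp)

/-- Degree vectors of total degree `2 * n - k` whose six face sums are at most `n`. -/
def faceDegrees (n k : ℕ) : Finset (Fin 8 → ℕ) :=
  (Fintype.piFinset fun _ => Finset.range (n + 1)).filter fun a =>
    a 0 + a 1 + a 2 + a 3 ≤ n ∧ a 4 + a 5 + a 6 + a 7 ≤ n ∧
    a 0 + a 1 + a 4 + a 5 ≤ n ∧ a 2 + a 3 + a 6 + a 7 ≤ n ∧
    a 0 + a 2 + a 4 + a 6 ≤ n ∧ a 1 + a 3 + a 5 + a 7 ≤ n ∧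
    ∑ i, a i + k = 2 * n

/-- The entries at `3, 5, 6, 7` and the slacks of three faces determine a degree vector. -/
theorem card_faceDegrees_le (n k : ℕ) :
    (faceDegrees n k).card ≤ (n + 1) ^ 4 * (k + 1) ^ 3 := by
  have h := Finset.card_le_card_of_injOn (s := faceDegrees n k)
    (t := (Fintype.piFinset fun _ : Fin 4 => Finset.range (n + 1)) ×ˢ
      (Fintype.piFinset fun _ : Fin 3 => Finset.range (k + 1)))
    (fun a => (![a 3, a 5, a 6, a 7], ![n - (a 0 + a 1 + a 2 + a 3),
      n - (a 0 + a 1 + a 4 + a 5), n - (a 0 + a 2 + a 4 + a 6)])) ?_ ?_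
  · simpa using h
  · intro a ha
    simp only [faceDegrees, Finset.coe_filter, Set.mem_ofPred_eq, Fin.sum_univ_eight] at ha
    simp only [Finset.coe_product, Set.mem_prod, Finset.mem_coe, Fintype.mem_piFinset,
      Finset.mem_range, Fin.forall_fin_succ, Matrix.cons_val_zero, Matrix.cons_val_succ,
      IsEmpty.forall_iff, and_true]
    omega
  · intro a ha b hb hab
    simp only [faceDegrees, Finset.coe_filter, Set.mem_ofPred_eq, Fin.sum_univ_eight] at ha hb
    simp only [Prod.mk.injEq, Matrix.vecCons_inj, and_true] at hab
    funext i
    fin_cases i <;> simp <;> omega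

theorem sum_card_faceDegrees_mul_pow_le (n : ℕ) (hn : 0 < n) (q : ℝ) (hq : 2 ≤ q) :
    ∑ k ∈ Finset.range (2 * n + 1), ((faceDegrees n k).card : ℝ) * q ^ (2 * n - k) ≤
      16 * (∑' k : ℕ, ((k : ℝ) + 1) ^ 3 * (1 / 2) ^ k) * (n : ℝ) ^ 4 * q ^ (2 * n) := by
  have hs : Summable fun k : ℕ => ((k : ℝ) + 1) ^ 3 * (1 / 2 : ℝ) ^ k := by
    have h := (summable_nat_add_iff 1).2
      (summable_pow_mul_geometric_of_norm_lt_one 3 (r := (1 / 2 : ℝ)) (by norm_num))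
    refine (h.mul_left 2).congr fun k => ?_
    push_cast
    ring
  have hn1 : ((n : ℝ) + 1) ^ 4 ≤ 16 * (n : ℝ) ^ 4 := by
    have : (1 : ℝ) ≤ n := by exact_mod_cast hn
    calc ((n : ℝ) + 1) ^ 4 ≤ (2 * n) ^ 4 := by gcongr; linarith
      _ = _ := by ring
  calc ∑ k ∈ Finset.range (2 * n + 1), ((faceDegrees n k).card : ℝ) * q ^ (2 * n - k)
      ≤ ∑ k ∈ Finset.range (2 * n + 1), (16 * (n : ℝ) ^ 4 * q ^ (2 * n)) *
          (((k : ℝ) + 1) ^ 3 * (1 / 2) ^ k) := by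
        refine Finset.sum_le_sum fun k hk => ?_
        have hk : k ≤ 2 * n := by simpa [Nat.lt_succ_iff] using hk
        have hc : ((faceDegrees n k).card : ℝ) ≤ ((n : ℝ) + 1) ^ 4 * ((k : ℝ) + 1) ^ 3 := by
          exact_mod_cast card_faceDegrees_le n k
        have hp : q ^ (2 * n - k) ≤ q ^ (2 * n) * (1 / 2) ^ k := by
          rw [one_div, inv_pow, ← div_eq_mul_inv, le_div_iff₀ (by positivity)]
          calc q ^ (2 * n - k) * 2 ^ k ≤ q ^ (2 * n - k) * q ^ k := by gcongr
            _ = _ := by rw [← pow_add, Nat.sub_add_cancel hk]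
        calc _ ≤ (16 * (n : ℝ) ^ 4 * ((k : ℝ) + 1) ^ 3) * (q ^ (2 * n) * (1 / 2) ^ k) := by
              gcongr
              exact hc.trans (by gcongr)
          _ = _ := by ring
    _ ≤ (16 * (n : ℝ) ^ 4 * q ^ (2 * n)) * ∑' k : ℕ, ((k : ℝ) + 1) ^ 3 * (1 / 2) ^ k := by
        rw [← Finset.mul_sum]
        gcongr
        exact hs.sum_le_tsum _ fun k _ => by positivity
    _ = _ := by ring

/-- Lemma 10: there is an absolute constant `C > 0` such that for every finite field `F`
(of prime-power size `q = |F|`) and every positive integer `n`, the set `X_n*` of 8-tuples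
`(f₁,…,f₈) ∈ P_n⁸` with the six products `f₁f₂f₃f₄, f₅f₆f₇f₈, f₁f₂f₅f₆, f₃f₄f₇f₈,
f₁f₃f₅f₇, f₂f₄f₆f₈` of degree at most `n` and
`gcd(f₃f₄, f₅f₆) = gcd(f₂f₄, f₅f₇) = gcd(f₂, f₃) = gcd(f₆, f₇) = 1`
has size at most `C·n⁴·q^{2n}`. -/
theorem card_X_n_star_bound :
    ∃ C : ℝ, 0 < C ∧
      ∀ (F : Type) [Field F] [Fintype F], ∀ n : ℕ, 0 < n →
        (Set.ncard {f : Fin 8 → F[X] |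
            (∀ i, (f i).Monic ∧ (f i).natDegree ≤ n) ∧
            (f 0 * f 1 * f 2 * f 3).natDegree ≤ n ∧
            (f 4 * f 5 * f 6 * f 7).natDegree ≤ n ∧
            (f 0 * f 1 * f 4 * f 5).natDegree ≤ n ∧
            (f 2 * f 3 * f 6 * f 7).natDegree ≤ n ∧
            (f 0 * f 2 * f 4 * f 6).natDegree ≤ n ∧
            (f 1 * f 3 * f 5 * f 7).natDegree ≤ n ∧
            IsCoprime (f 2 * f 3) (f 4 * f 5) ∧
            IsCoprime (f 1 * f 3) (f 4 * f 6) ∧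
            IsCoprime (f 1) (f 2) ∧
            IsCoprime (f 5) (f 6)} : ℝ) ≤
          C * (n : ℝ) ^ 4 * (Fintype.card F : ℝ) ^ (2 * n) := by
  refine ⟨16 * (∑' k : ℕ, ((k : ℝ) + 1) ^ 3 * (1 / 2) ^ k) + 1, ?_, ?_⟩
  · have : 0 ≤ ∑' k : ℕ, ((k : ℝ) + 1) ^ 3 * (1 / 2 : ℝ) ^ k :=
      tsum_nonneg fun k => by positivity
    linarith
  intro F _ _ n hn
  classical
  choose M hM hMcard using exists_finset_monic_natDegree_eq F
  have hq : (2 : ℝ) ≤ Fintype.card F := by exact_mod_cast Fintype.one_lt_card (α := F)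
  set T : Finset (Fin 8 → F[X]) := (Finset.range (2 * n + 1)).biUnion fun k =>
    (faceDegrees n k).biUnion fun a => Fintype.piFinset fun i => M (a i) with hT
  have hTcard : T.card ≤ ∑ k ∈ Finset.range (2 * n + 1),
      (faceDegrees n k).card * Fintype.card F ^ (2 * n - k) := by
    refine Finset.card_biUnion_le.trans (Finset.sum_le_sum fun k _ => ?_)
    refine Finset.card_biUnion_le_card_mul _ _ _ fun a ha => ?_
    have hsum : ∑ i, a i = 2 * n - k := by
      simp only [faceDegrees, Finset.mem_filter] at ha
      omega
    rw [Fintype.card_piFinset, ← hsum, ← Finset.prod_pow_eq_pow_sum]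
    exact Finset.prod_le_prod' fun i _ => hMcard _
  have hTreal : (T.card : ℝ) ≤ ∑ k ∈ Finset.range (2 * n + 1),
      ((faceDegrees n k).card : ℝ) * (Fintype.card F : ℝ) ^ (2 * n - k) := by
    exact_mod_cast hTcard
  refine le_trans (Nat.cast_le.2 ((Set.ncard_le_ncard (t := (T : Set (Fin 8 → F[X]))) ?_
    T.finite_toSet).trans_eq (Set.ncard_coe_finset T)))
    ((hTreal.trans (sum_card_faceDegrees_mul_pow_le n hn _ hq)).trans ?_)
  · rintro f ⟨hf, h1, h2, h3, h4, h5, h6, -⟩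
    have hdeg : ∀ i j k l, (f i * f j * f k * f l).natDegree =
        (f i).natDegree + (f j).natDegree + (f k).natDegree + (f l).natDegree := by
      intro i j k l
      have hne := fun i => (hf i).1.ne_zero
      rw [natDegree_mul (mul_ne_zero (mul_ne_zero (hne i) (hne j)) (hne k)) (hne l),
        natDegree_mul (mul_ne_zero (hne i) (hne j)) (hne k), natDegree_mul (hne i) (hne j)]
    rw [hdeg] at h1 h2 h3 h4 h5 h6
    simp only [hT, Finset.mem_coe, Finset.mem_biUnion, Finset.mem_range, Fintype.mem_piFinset]
    refine ⟨2 * n - ∑ i, (f i).natDegree, by omega, fun i => (f i).natDegree, ?_,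
      fun i => hM _ _ ⟨(hf i).1, rfl⟩⟩
    simp only [faceDegrees, Finset.mem_filter, Fintype.mem_piFinset, Finset.mem_range,
      Nat.lt_succ_iff]
    refine ⟨fun i => (hf i).2, h1, h2, h3, h4, h5, h6, ?_⟩
    rw [Fin.sum_univ_eight]
    omega
  · gcongr
    linarith
end

section
/- For every real ε > 0 there exist constants κ > 0 and C > 0, depending only on ε, such that for every prime power q and every integer m ≥ 2, the number of polynomials s ∈ M_m with Φ(s) ≥ m^{ε + ln 2} is at most C·m^{−κ}·q^m; equivalently, if s is drawn uniformly at random from M_m, then Prob{Φ(s) ≥ m^{ε + ln 2}} ≤ C·m^{−κ}. -/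
open Polynomial

/-- `Φ(s)`: the number of distinct monic divisors of `s` in `F[x]`. -/
noncomputable def numDiv {F : Type} [Field F] (s : F[X]) : ℕ :=
  Set.ncard {d : F[X] | d.Monic ∧ d ∣ s}

open scoped Classical in
open UniqueFactorizationMonoid in
/-- The number of divisors is bounded by the product over the prime factors of their
multiplicity plus one. -/
theorem numDiv_le_prod_count {F : Type} [Field F] {s : F[X]} (hs : s ≠ 0) :
    numDiv s ≤ ∏ P ∈ (normalizedFactors s).toFinset, ((normalizedFactors s).count P + 1) := by
  rw [← Multiset.card_Iic, numDiv, ← Set.ncard_coe_finset]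
  refine Set.ncard_le_ncard_of_injOn normalizedFactors ?_ ?_ (Finset.finite_toSet _)
  · rintro d ⟨hd, hds⟩
    simpa using (dvd_iff_normalizedFactors_le_normalizedFactors hd.ne_zero hs).1 hds
  · rintro d ⟨hd, -⟩ e ⟨he, -⟩ hde
    refine eq_of_monic_of_associated hd he ?_
    exact (associated_iff_normalizedFactors_eq_normalizedFactors hd.ne_zero he.ne_zero).2 hde

theorem natCard_monic_natDegree_eq (F : Type) [Field F] [Fintype F] (n : ℕ) :
    Nat.card {p : F[X] // p.Monic ∧ p.natDegree = n} = Fintype.card F ^ n := by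
  rw [Nat.card_congr ((monicEquivDegreeLT n).trans (degreeLTEquiv F n).toEquiv)]
  simp [Nat.card_eq_fintype_card]

theorem finite_monic_natDegree_eq (F : Type) [Field F] [Fintype F] (n : ℕ) :
    {p : F[X] | p.Monic ∧ p.natDegree = n}.Finite :=
  Set.finite_coe_iff.1 (Nat.finite_of_card_ne_zero (by
    rw [Set.coe_ofPred, natCard_monic_natDegree_eq]
    exact pow_ne_zero _ Fintype.card_ne_zero))

/-- The monic polynomials of degree `n`. -/
noncomputable def monics (F : Type) [Field F] [Fintype F] (n : ℕ) : Finset F[X] :=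
  (finite_monic_natDegree_eq F n).toFinset

@[simp]
theorem mem_monics {F : Type} [Field F] [Fintype F] {n : ℕ} {p : F[X]} :
    p ∈ monics F n ↔ p.Monic ∧ p.natDegree = n := by
  simp [monics]

theorem card_monics (F : Type) [Field F] [Fintype F] (n : ℕ) :
    (monics F n).card = Fintype.card F ^ n := by
  rw [← natCard_monic_natDegree_eq, monics,
    ← Set.ncard_eq_toFinset_card _ (finite_monic_natDegree_eq F n)]
  rfl

open scoped Classical in
theorem card_monics_filter_dvd_le {F : Type} [Field F] [Fintype F] (n : ℕ) {D : F[X]}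
    (hD : D.Monic) :
    (((monics F n).filter (D ∣ ·)).card : ℝ) ≤
      (Fintype.card F : ℝ) ^ n * ((Fintype.card F : ℝ) ^ D.natDegree)⁻¹ := by
  have hq : (0 : ℝ) < Fintype.card F := by exact_mod_cast Fintype.card_pos
  rcases le_or_gt D.natDegree n with h | h
  · have hsub : (monics F n).filter (D ∣ ·) ⊆ (monics F (n - D.natDegree)).image (D * ·) := by
      intro s hs
      obtain ⟨⟨hs, hn⟩, t, rfl⟩ := by simpa using hs
      have ht : t.Monic := hD.of_mul_monic_left hs
      rw [hD.natDegree_mul ht] at hn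
      simp only [Finset.mem_image, mem_monics]
      exact ⟨t, ⟨ht, by omega⟩, rfl⟩
    have hc := (Finset.card_le_card hsub).trans Finset.card_image_le
    rw [card_monics] at hc
    calc (((monics F n).filter (D ∣ ·)).card : ℝ) ≤ (Fintype.card F : ℝ) ^ (n - D.natDegree) := by
          exact_mod_cast hc
      _ = _ := pow_sub₀ _ hq.ne' h
  · rw [Finset.filter_false_of_mem]
    · simp only [Finset.card_empty, Nat.cast_zero]
      positivity
    · intro s hs hDs
      rw [mem_monics] at hs
      have := natDegree_le_of_dvd hDs hs.1.ne_zero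
      omega

open scoped Classical in
/-- The monic irreducible polynomials of degree `n`. -/
noncomputable def monicIrreducibles (F : Type) [Field F] [Fintype F] (n : ℕ) : Finset F[X] :=
  (monics F n).filter Irreducible

@[simp]
theorem mem_monicIrreducibles {F : Type} [Field F] [Fintype F] {n : ℕ} {p : F[X]} :
    p ∈ monicIrreducibles F n ↔ (p.Monic ∧ p.natDegree = n) ∧ Irreducible p := by
  simp [monicIrreducibles]

theorem isCoprime_of_monic_irreducible_of_ne {F : Type} [Field F] {P Q : F[X]} (hP : P.Monic)
    (hQ : Q.Monic) (hPi : Irreducible P) (hQi : Irreducible Q) (hne : P ≠ Q) : IsCoprime P Q := by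
  refine hPi.coprime_iff_not_dvd.2 fun h => hne ?_
  exact eq_of_monic_of_associated hP hQ (hPi.associated_of_dvd hQi h)

theorem mul_card_monicIrreducibles_le (F : Type) [Field F] [Fintype F] {n : ℕ} (hn : n ≠ 0) :
    n * (monicIrreducibles F n).card ≤ Fintype.card F ^ n := by
  have hdvd : ∏ P ∈ monicIrreducibles F n, P ∣ X ^ Fintype.card F ^ n - X := by
    refine Finset.prod_dvd_of_coprime (fun P hP Q hQ hne => ?_) fun P hP => ?_
    · simp only [Finset.mem_coe, mem_monicIrreducibles] at hP hQ
      exact isCoprime_of_monic_irreducible_of_ne hP.1.1 hQ.1.1 hP.2 hQ.2 hne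
    · rw [mem_monicIrreducibles] at hP
      rw [← Nat.card_eq_fintype_card]
      exact hP.2.natDegree_dvd_iff_dvd_X_pow_card_pow_sub_X.1 (by rw [hP.1.2])
  have h := natDegree_le_of_dvd hdvd
    (FiniteField.X_pow_card_pow_sub_X_ne_zero F hn Fintype.one_lt_card)
  rw [FiniteField.X_pow_card_pow_sub_X_natDegree_eq F hn Fintype.one_lt_card,
    natDegree_prod_of_monic _ _ fun P hP => (mem_monicIrreducibles.1 hP).1.1,
    Finset.sum_congr rfl fun P hP => (mem_monicIrreducibles.1 hP).1.2] at h
  simpa [mul_comm] using h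

open scoped Classical in
/-- The monic irreducible polynomials of degree at most `m`. -/
noncomputable def monicIrreduciblesLE (F : Type) [Field F] [Fintype F] (m : ℕ) : Finset F[X] :=
  (Finset.Icc 1 m).biUnion (monicIrreducibles F)

theorem mem_monicIrreduciblesLE {F : Type} [Field F] [Fintype F] {m : ℕ} {p : F[X]} :
    p ∈ monicIrreduciblesLE F m ↔ p.Monic ∧ Irreducible p ∧ p.natDegree ≤ m := by
  simp only [monicIrreduciblesLE, Finset.mem_biUnion, Finset.mem_Icc, mem_monicIrreducibles]
  constructor
  · rintro ⟨n, hn, ⟨hp, rfl⟩, hi⟩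
    exact ⟨hp, hi, hn.2⟩
  · rintro ⟨hp, hi, h⟩
    exact ⟨_, ⟨hi.natDegree_pos, h⟩, ⟨hp, rfl⟩, hi⟩

/-- A Mertens-type upper bound over `F[x]`. -/
theorem sum_inv_sub_one_le (F : Type) [Field F] [Fintype F] (m : ℕ) :
    ∑ P ∈ monicIrreduciblesLE F m, ((Fintype.card F : ℝ) ^ P.natDegree - 1)⁻¹ ≤
      3 + Real.log m := by
  classical
  have hq : (2 : ℝ) ≤ Fintype.card F := by exact_mod_cast Fintype.one_lt_card (α := F)
  rw [monicIrreduciblesLE, Finset.sum_biUnion]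
  · have hstep : ∀ j ∈ Finset.Icc 1 m,
        ∑ P ∈ monicIrreducibles F j, ((Fintype.card F : ℝ) ^ P.natDegree - 1)⁻¹ ≤
          (j : ℝ)⁻¹ + 2 * (1 / 2) ^ j := by
      intro j hj
      have hj1 : 1 ≤ j := (Finset.mem_Icc.1 hj).1
      have hjr : (1 : ℝ) ≤ j := by exact_mod_cast hj1
      have hc : (j : ℝ) * (monicIrreducibles F j).card ≤ (Fintype.card F : ℝ) ^ j := by
        exact_mod_cast mul_card_monicIrreducibles_le F (by omega)
      rw [Finset.sum_congr rfl fun P hP => by rw [(mem_monicIrreducibles.1 hP).1.2],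
        Finset.sum_const, nsmul_eq_mul]
      have hx2 : (2 : ℝ) ^ j ≤ (Fintype.card F : ℝ) ^ j := by gcongr
      have h2 : (2 : ℝ) ≤ 2 ^ j := by simpa using pow_le_pow_right₀ (one_le_two (α := ℝ)) hj1
      generalize (Fintype.card F : ℝ) ^ j = x at *
      have hx1 : 0 < x - 1 := by linarith
      calc ((monicIrreducibles F j).card : ℝ) * (x - 1)⁻¹ ≤ x / j * (x - 1)⁻¹ := by
            gcongr
            rw [le_div_iff₀ (by positivity)]
            linarith
        _ = (j : ℝ)⁻¹ + (j : ℝ)⁻¹ * (x - 1)⁻¹ := by field_simp; ring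
        _ ≤ (j : ℝ)⁻¹ + 1 * (2 * (2 ^ j)⁻¹) := by
            gcongr
            · exact inv_le_one_of_one_le₀ hjr
            · rw [← div_eq_mul_inv, inv_eq_one_div, div_le_div_iff₀ hx1 (by positivity)]
              linarith
        _ = _ := by rw [one_mul, one_div, inv_pow]
    have hharm : ∑ j ∈ Finset.Icc 1 m, (j : ℝ)⁻¹ ≤ 1 + Real.log m := by
      have := harmonic_le_one_add_log m
      simpa only [harmonic_eq_sum_Icc, Rat.cast_sum, Rat.cast_inv, Rat.cast_natCast] using this
    have hgeom : ∑ j ∈ Finset.Icc 1 m, (1 / 2 : ℝ) ^ j ≤ 1 := by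
      have h := sum_geometric_two_le (m + 1)
      rw [Finset.range_eq_Ico, Finset.sum_eq_sum_Ico_succ_bot (by omega)] at h
      have : Finset.Icc 1 m = Finset.Ico (0 + 1) (m + 1) := by ext; simp
      rw [this]
      linarith
    refine (Finset.sum_le_sum hstep).trans ?_
    rw [Finset.sum_add_distrib, ← Finset.mul_sum]
    linarith
  · intro i _ j _ hij
    refine Finset.disjoint_left.2 fun P hi hj => hij ?_
    rw [← (mem_monicIrreducibles.1 hi).1.2, (mem_monicIrreducibles.1 hj).1.2]

theorem natCast_add_one_rpow_le {t : ℝ} (h0 : 0 ≤ t) (h1 : t ≤ 1) (k : ℕ) :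
    ((k : ℝ) + 1) ^ t ≤ 1 + k * (2 ^ t - 1) := by
  rcases Nat.eq_zero_or_pos k with rfl | hk
  · simp
  have hk1 : (1 : ℝ) ≤ k := by exact_mod_cast hk
  have hk0 : (k : ℝ) ≠ 0 := by positivity
  have ha : (0 : ℝ) ≤ (k - 1) / k := div_nonneg (by linarith) (by linarith)
  have hb : (0 : ℝ) ≤ 1 / k := by positivity
  have hab : ((k : ℝ) - 1) / k + 1 / k = 1 := by field_simp; ring
  have hc := (Real.concaveOn_rpow h0 h1).2 (Set.mem_Ici.2 zero_le_one)
    (Set.mem_Ici.2 (by positivity : (0 : ℝ) ≤ k + 1)) ha hb hab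
  have he : ((k : ℝ) - 1) / k * 1 + 1 / k * (k + 1) = 2 := by field_simp; ring
  simp only [smul_eq_mul, he, Real.one_rpow] at hc
  have := mul_le_mul_of_nonneg_left hc (by linarith : (0 : ℝ) ≤ k)
  field_simp at this
  linarith

open scoped Classical in
open UniqueFactorizationMonoid in
theorem numDiv_rpow_le_prod {F : Type} [Field F] [Fintype F] {m : ℕ} {s : F[X]}
    (hs : s ∈ monics F m) {t : ℝ} (h0 : 0 ≤ t) (h1 : t ≤ 1) :
    (numDiv s : ℝ) ^ t ≤ ∏ P ∈ monicIrreduciblesLE F m, ∑ k ∈ Finset.range (m + 1),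
      (if k = 0 then 1 else (2 : ℝ) ^ t - 1) * if P ^ k ∣ s then 1 else 0 := by
  obtain ⟨hsm, hsd⟩ := mem_monics.1 hs
  have hδ : (0 : ℝ) ≤ 2 ^ t - 1 := sub_nonneg.2 (Real.one_le_rpow one_le_two h0)
  have hnn : ∀ (P : F[X]) (k : ℕ), (0 : ℝ) ≤
      (if k = 0 then 1 else (2 : ℝ) ^ t - 1) * if P ^ k ∣ s then 1 else 0 := by
    intro P k
    split_ifs <;> simp [hδ]
  have hnd : (numDiv s : ℝ) ≤
      ∏ P ∈ (normalizedFactors s).toFinset, (((normalizedFactors s).count P : ℝ) + 1) := by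
    exact_mod_cast numDiv_le_prod_count hsm.ne_zero
  have hfac : ∀ P ∈ (normalizedFactors s).toFinset, P ∈ monicIrreduciblesLE F m := by
    intro P hP
    rw [Multiset.mem_toFinset] at hP
    have hi := irreducible_of_normalized_factor P hP
    refine mem_monicIrreduciblesLE.2 ⟨?_, hi, ?_⟩
    · rw [← normalize_normalized_factor P hP]
      exact monic_normalize hi.ne_zero
    · rw [← hsd]
      exact natDegree_le_of_dvd (dvd_of_mem_normalizedFactors hP) hsm.ne_zero
  calc (numDiv s : ℝ) ^ t
      ≤ (∏ P ∈ (normalizedFactors s).toFinset, (((normalizedFactors s).count P : ℝ) + 1)) ^ t :=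
        Real.rpow_le_rpow (by positivity) hnd h0
    _ = ∏ P ∈ (normalizedFactors s).toFinset, (((normalizedFactors s).count P : ℝ) + 1) ^ t :=
        (Real.finsetProd_rpow _ _ (fun _ _ => by positivity) t).symm
    _ ≤ ∏ P ∈ (normalizedFactors s).toFinset, ∑ k ∈ Finset.range (m + 1),
          (if k = 0 then 1 else (2 : ℝ) ^ t - 1) * if P ^ k ∣ s then 1 else 0 := by
        refine Finset.prod_le_prod (fun _ _ => by positivity) fun P hP => ?_
        have hPS := mem_monicIrreduciblesLE.1 (hfac P hP)
        set e := (normalizedFactors s).count P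
        have hdvd : ∀ k ≤ e, P ^ k ∣ s := by
          intro k hk
          rw [dvd_iff_normalizedFactors_le_normalizedFactors (pow_ne_zero _ hPS.2.1.ne_zero)
            hsm.ne_zero, hPS.2.1.normalizedFactors_pow, hPS.1.normalize_eq_self]
          exact Multiset.le_count_iff_replicate_le.1 hk
        have hem : e ≤ m := by
          have := natDegree_le_of_dvd (hdvd e le_rfl) hsm.ne_zero
          rw [natDegree_pow, hsd] at this
          exact (Nat.le_mul_of_pos_right e hPS.2.1.natDegree_pos).trans this
        refine (natCast_add_one_rpow_le h0 h1 e).trans ?_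
        calc 1 + (e : ℝ) * (2 ^ t - 1)
            = ∑ k ∈ Finset.range (e + 1),
              (if k = 0 then 1 else (2 : ℝ) ^ t - 1) * if P ^ k ∣ s then 1 else 0 := by
              rw [Finset.sum_range_succ', Finset.sum_congr rfl (g := fun _ => (2 : ℝ) ^ t - 1)]
              · simp only [Finset.sum_const, Finset.card_range, nsmul_eq_mul]
                simp [add_comm]
              · intro k hk
                rw [if_pos (hdvd _ (Finset.mem_range.1 hk))]
                simp
          _ ≤ _ := Finset.sum_le_sum_of_subset_of_nonneg
              (Finset.range_mono (by omega)) fun k _ _ => hnn P k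
    _ ≤ _ := by
        refine Finset.prod_le_prod_of_subset_of_one_le hfac
          (fun P _ => Finset.sum_nonneg fun k _ => hnn P k) fun P _ _ => ?_
        refine le_trans ?_ (Finset.single_le_sum (fun k _ => hnn P k)
          (Finset.mem_range.2 m.succ_pos))
        simp

theorem sum_range_weight_le {x δ : ℝ} (hx : 1 < x) (hδ : 0 ≤ δ) (m : ℕ) :
    ∑ k ∈ Finset.range (m + 1), (if k = 0 then 1 else δ) * (x ^ k)⁻¹ ≤
      Real.exp (δ * (x - 1)⁻¹) := by
  have hx0 : x ≠ 0 := by positivity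
  have hx1 : 0 < x - 1 := by linarith
  have hgeom : ∑ k ∈ Finset.range m, (x ^ (k + 1))⁻¹ ≤ (x - 1)⁻¹ := by
    have : ∀ n : ℕ, ∑ k ∈ Finset.range n, (x ^ (k + 1))⁻¹ = (x - 1)⁻¹ * (1 - (x ^ n)⁻¹) := by
      intro n
      induction n with
      | zero => simp
      | succ n ih =>
        rw [Finset.sum_range_succ, ih]
        field_simp
        ring
    rw [this]
    refine mul_le_of_le_one_right (by positivity) ?_
    have : 0 < (x ^ m)⁻¹ := by positivity
    linarith
  rw [Finset.sum_range_succ']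
  simp only [Nat.add_eq_zero_iff, one_ne_zero, and_false, if_false, if_true, pow_zero, inv_one,
    mul_one, ← Finset.mul_sum]
  have := Real.add_one_le_exp (δ * (x - 1)⁻¹)
  have := mul_le_mul_of_nonneg_left hgeom hδ
  linarith

theorem sum_numDiv_rpow_le (F : Type) [Field F] [Fintype F] {m : ℕ} (hm : m ≠ 0) {t : ℝ}
    (h0 : 0 ≤ t) (h1 : t ≤ 1) :
    ∑ s ∈ monics F m, (numDiv s : ℝ) ^ t ≤
      Real.exp (3 * (2 ^ t - 1)) * (m : ℝ) ^ ((2 : ℝ) ^ t - 1) * (Fintype.card F : ℝ) ^ m := by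
  classical
  have hδ : (0 : ℝ) ≤ 2 ^ t - 1 := sub_nonneg.2 (Real.one_le_rpow one_le_two h0)
  set δ : ℝ := 2 ^ t - 1
  set q : ℝ := (Fintype.card F : ℝ) with hqdef
  have hq : 1 < q := by rw [hqdef]; exact_mod_cast Fintype.one_lt_card (α := F)
  set S := monicIrreduciblesLE F m
  set w : ℕ → ℝ := fun k => if k = 0 then 1 else δ with hw
  have hw0 : ∀ k, 0 ≤ w k := by
    intro k
    simp only [hw]
    split_ifs <;> simp [hδ]
  have hcount : ∀ p : ∀ P ∈ S, ℕ,
      ∑ s ∈ monics F m, ∏ P ∈ S.attach, (if P.1 ^ p P.1 P.2 ∣ s then (1 : ℝ) else 0) ≤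
        q ^ m * ∏ P ∈ S.attach, ((q ^ P.1.natDegree) ^ p P.1 P.2)⁻¹ := by
    intro p
    have hmonic : ∀ P ∈ S.attach, (P.1 ^ p P.1 P.2).Monic := fun P _ =>
      (mem_monicIrreduciblesLE.1 P.2).1.pow _
    have key := card_monics_filter_dvd_le m (monic_prod_of_monic S.attach _ hmonic)
    rw [natDegree_prod_of_monic _ _ hmonic] at key
    rw [Finset.prod_inv_distrib]
    simp_rw [← pow_mul]
    rw [Finset.prod_pow_eq_pow_sum]
    simp_rw [natDegree_pow, mul_comm (p _ _)] at key
    refine le_trans ?_ key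
    rw [Finset.card_filter]
    push_cast
    refine Finset.sum_le_sum fun s _ => ?_
    rw [Finset.prod_ite_zero]
    simp only [Finset.prod_const_one]
    split_ifs with ha hb
    · exact le_rfl
    · refine absurd (Finset.prod_dvd_of_coprime (fun P _ Q _ hne => ?_) ha) hb
      have hP := mem_monicIrreduciblesLE.1 P.2
      have hQ := mem_monicIrreduciblesLE.1 Q.2
      exact (isCoprime_of_monic_irreducible_of_ne hP.1 hQ.1 hP.2.1 hQ.2.1
        (Subtype.coe_ne_coe.2 hne)).pow
    · exact zero_le_one
    · exact le_rfl
  have hm0 : (0 : ℝ) < m := by positivity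
  calc ∑ s ∈ monics F m, (numDiv s : ℝ) ^ t
      ≤ ∑ s ∈ monics F m, ∏ P ∈ S, ∑ k ∈ Finset.range (m + 1),
          w k * if P ^ k ∣ s then 1 else 0 :=
        Finset.sum_le_sum fun s hs => numDiv_rpow_le_prod hs h0 h1
    _ = ∑ p ∈ S.pi fun _ => Finset.range (m + 1), (∏ P ∈ S.attach, w (p P.1 P.2)) *
          ∑ s ∈ monics F m, ∏ P ∈ S.attach, (if P.1 ^ p P.1 P.2 ∣ s then (1 : ℝ) else 0) := by
        simp_rw [Finset.prod_sum, Finset.prod_mul_distrib, Finset.mul_sum]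
        rw [Finset.sum_comm]
    _ ≤ ∑ p ∈ S.pi fun _ => Finset.range (m + 1), (∏ P ∈ S.attach, w (p P.1 P.2)) *
          (q ^ m * ∏ P ∈ S.attach, ((q ^ P.1.natDegree) ^ p P.1 P.2)⁻¹) :=
        Finset.sum_le_sum fun p _ =>
          mul_le_mul_of_nonneg_left (hcount p) (Finset.prod_nonneg fun _ _ => hw0 _)
    _ = q ^ m * ∏ P ∈ S, ∑ k ∈ Finset.range (m + 1), w k * ((q ^ P.natDegree) ^ k)⁻¹ := by
        simp_rw [Finset.prod_sum, Finset.prod_mul_distrib, Finset.mul_sum]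
        exact Finset.sum_congr rfl fun _ _ => mul_left_comm _ _ _
    _ ≤ q ^ m * ∏ P ∈ S, Real.exp (δ * (q ^ P.natDegree - 1)⁻¹) := by
        gcongr with P hP
        exact sum_range_weight_le
          (one_lt_pow₀ hq (mem_monicIrreduciblesLE.1 hP).2.1.natDegree_pos.ne') hδ m
    _ = q ^ m * Real.exp (δ * ∑ P ∈ S, (q ^ P.natDegree - 1)⁻¹) := by
        rw [← Real.exp_sum, Finset.mul_sum]
    _ ≤ q ^ m * Real.exp (δ * (3 + Real.log m)) := by
        gcongr
        exact sum_inv_sub_one_le F m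
    _ = Real.exp (3 * δ) * (m : ℝ) ^ δ * q ^ m := by
        rw [Real.rpow_def_of_pos hm0, ← Real.exp_add]
        ring_nf

theorem exists_two_rpow_sub_one_lt {ε : ℝ} (hε : 0 < ε) :
    ∃ t : ℝ, 0 < t ∧ t ≤ 1 ∧ (2 : ℝ) ^ t - 1 < t * (ε + Real.log 2) := by
  refine ⟨min 1 ε, lt_min one_pos hε, min_le_left _ _, ?_⟩
  have ht : 0 < min 1 ε := lt_min one_pos hε
  have ht1 : min 1 ε ≤ 1 := min_le_left _ _
  have htε : min 1 ε ≤ ε := min_le_right _ _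
  generalize min 1 ε = t at *
  have hl0 : 0 < Real.log 2 := Real.log_pos one_lt_two
  have hl1 : Real.log 2 < 1 := Real.log_two_lt_d9.trans (by norm_num)
  have hlt : Real.log 2 * t < t := mul_lt_of_lt_one_left ht hl1
  have hpos : 0 < Real.log 2 * t := by positivity
  have h := (abs_le.1 (Real.abs_exp_sub_one_sub_id_le (x := Real.log 2 * t)
    (by rw [abs_of_pos hpos]; linarith))).2
  rw [Real.rpow_def_of_pos two_pos]
  nlinarith

/-- Proposition 6: for every `ε > 0` there are `κ, C > 0` (depending only on `ε`) such that
for every finite field `F` (of prime-power size `q = |F|`) and every integer `m ≥ 2`, the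
number of monic `s` of degree `m` with `Φ(s) ≥ m^{ε + ln 2}` is at most `C·m^{−κ}·q^m`;
equivalently, `Prob{Φ_m ≥ m^{ε + ln 2}} ≤ C·m^{−κ}` for `s` uniform on `M_m`. -/
theorem chernoff_tail_numDiv :
    ∀ ε : ℝ, 0 < ε → ∃ κ C : ℝ, 0 < κ ∧ 0 < C ∧
      ∀ (F : Type) [Field F] [Fintype F], ∀ m : ℕ, 2 ≤ m →
        (Set.ncard {s : F[X] | s.Monic ∧ s.natDegree = m ∧
            (m : ℝ) ^ (ε + Real.log 2) ≤ (numDiv s : ℝ)} : ℝ) ≤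
          C * (m : ℝ) ^ (-κ) * (Fintype.card F : ℝ) ^ m := by
  intro ε hε
  obtain ⟨t, ht0, ht1, ht⟩ := exists_two_rpow_sub_one_lt hε
  refine ⟨t * (ε + Real.log 2) - (2 ^ t - 1), Real.exp (3 * (2 ^ t - 1)), by linarith,
    Real.exp_pos _, ?_⟩
  intro F _ _ m hm
  classical
  have hm0 : (0 : ℝ) < m := by positivity
  set a := ε + Real.log 2
  have hset : {s : F[X] | s.Monic ∧ s.natDegree = m ∧ (m : ℝ) ^ a ≤ (numDiv s : ℝ)} =
      ((monics F m).filter fun s => (m : ℝ) ^ a ≤ (numDiv s : ℝ) : Finset F[X]) := by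
    ext s
    simp [and_assoc]
  rw [hset, Set.ncard_coe_finset]
  have hmarkov : (((monics F m).filter fun s => (m : ℝ) ^ a ≤ (numDiv s : ℝ)).card : ℝ) *
      (m : ℝ) ^ (t * a) ≤ ∑ s ∈ monics F m, (numDiv s : ℝ) ^ t := by
    rw [← nsmul_eq_mul]
    refine (Finset.card_nsmul_le_sum _ (fun s => (numDiv s : ℝ) ^ t) _ fun s hs => ?_).trans
      (Finset.sum_le_sum_of_subset_of_nonneg (Finset.filter_subset _ _)
        fun s _ _ => by positivity)
    rw [mul_comm, Real.rpow_mul hm0.le]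
    exact Real.rpow_le_rpow (by positivity) (Finset.mem_filter.1 hs).2 ht0.le
  rw [← le_div_iff₀ (by positivity)] at hmarkov
  refine hmarkov.trans ?_
  rw [div_le_iff₀ (by positivity)]
  refine (sum_numDiv_rpow_le F (by omega) ht0.le ht1).trans_eq ?_
  have : (m : ℝ) ^ ((2 : ℝ) ^ t - 1) =
      (m : ℝ) ^ (-(t * a - ((2 : ℝ) ^ t - 1))) * (m : ℝ) ^ (t * a) := by
    rw [← Real.rpow_add hm0]
    ring_nf
  rw [this]
  ring
end
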